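/- arXiv:2210.16733 — 2 statements merged into one kernel-verified Lean document; each statement's English description precedes it below -/
import Mathlib

section
/- Let d ≥ 2 and γ ∈ (0, d/2). There exists a constant C > 0, independent of N ≥ 1, of l ∈ ℤ^d₀ and of the unit vectors a, b ∈ ℝ^d, such that |∑_{k ∈ ℤ^d₀} (θ^N_k)² sin²(∠_{k,l}) (a·k)(b·k)/|k|² − ε_N ∫_{1 ≤ |x| ≤ N} |x|^{−2γ} sin²(∠_{x,l}) (a·x)(b·x)/|x|² dx| ≤ C D_N. -/
open MeasureTheory

/-- Euclidean norm of a lattice point `k ∈ ℤ^d`. -/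
noncomputable def znorm {d : ℕ} (k : Fin d → ℤ) : ℝ :=
  Real.sqrt (∑ i, ((k i : ℝ)) ^ 2)

/-- Euclidean norm of a point of `ℝ^d`. -/
noncomputable def rnorm {d : ℕ} (x : Fin d → ℝ) : ℝ :=
  Real.sqrt (∑ i, x i ^ 2)

/-- Euclidean inner product of two lattice points. -/
noncomputable def zdot {d : ℕ} (k l : Fin d → ℤ) : ℝ :=
  ∑ i, (k i : ℝ) * (l i : ℝ)

/-- Inner product of a real vector with a lattice point. -/
noncomputable def rdot {d : ℕ} (a : Fin d → ℝ) (k : Fin d → ℤ) : ℝ :=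
  ∑ i, a i * (k i : ℝ)

/-- `sin²(∠_{k,l}) = 1 - (k·l)²/(|k|²|l|²)` for lattice points. -/
noncomputable def sin2 {d : ℕ} (k l : Fin d → ℤ) : ℝ :=
  1 - zdot k l ^ 2 / (znorm k ^ 2 * znorm l ^ 2)

/-- `sin²(∠_{x,l}) = 1 - (x·l)²/(|x|²|l|²)` for `x ∈ ℝ^d` and a lattice point `l`. -/
noncomputable def sin2R {d : ℕ} (x : Fin d → ℝ) (l : Fin d → ℤ) : ℝ :=
  1 - (∑ i, x i * (l i : ℝ)) ^ 2 / (rnorm x ^ 2 * znorm l ^ 2)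

/-- `ε_N = (∑_{k ∈ ℤ^d₀, |k| ≤ N} |k|^{-2γ})⁻¹`. -/
noncomputable def epsN (d : ℕ) (γ : ℝ) (N : ℕ) : ℝ :=
  (∑' k : Fin d → ℤ, if k ≠ 0 ∧ znorm k ≤ N then znorm k ^ (-(2 : ℝ) * γ) else 0)⁻¹

/-- `θ^N_k = √ε_N |k|^{-γ} 1_{1 ≤ |k| ≤ N}`. -/
noncomputable def thetaN (d : ℕ) (γ : ℝ) (N : ℕ) (k : Fin d → ℤ) : ℝ :=
  if 1 ≤ znorm k ∧ znorm k ≤ N then Real.sqrt (epsN d γ N) * znorm k ^ (-γ) else 0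

/-- `D_N = ε_N ∑_{k ∈ ℤ^d₀, |k| ≤ N} |k|^{-2γ-1}`. -/
noncomputable def DN (d : ℕ) (γ : ℝ) (N : ℕ) : ℝ :=
  epsN d γ N *
    ∑' k : Fin d → ℤ, if k ≠ 0 ∧ znorm k ≤ N then znorm k ^ (-(2 : ℝ) * γ - 1) else 0

lemma abs_mul_sub_mul_le {x y x' y' s t : ℝ} (hy : |y| ≤ 1) (hx' : |x'| ≤ 1)
    (hx : |x - x'| ≤ s) (hyy : |y - y'| ≤ t) : |x * y - x' * y'| ≤ s + t := by
  have e : x * y - x' * y' = (x - x') * y + x' * (y - y') := by ring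
  rw [e]
  refine (abs_add_le _ _).trans ?_
  rw [abs_mul, abs_mul]
  have h1 := mul_le_mul hx hy (abs_nonneg _) ((abs_nonneg _).trans hx)
  have h2 := mul_le_mul hx' hyy (abs_nonneg _) zero_le_one
  linarith

lemma abs_rpow_neg_sub_rpow_neg_le {p m r s : ℝ} (hp : 0 < p) (hm : 0 < m)
    (hr : m ≤ r) (hs : m ≤ s) :
    |r ^ (-p) - s ^ (-p)| ≤ p * m ^ (-p - 1) * |r - s| := by
  have key := (convex_Ici m).norm_image_sub_le_of_norm_hasDerivWithin_le
    (f := fun x : ℝ => x ^ (-p)) (f' := fun x => -p * x ^ (-p - 1))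
    (C := p * m ^ (-p - 1)) (x := s) (y := r)
    (fun x hx => (Real.hasDerivAt_rpow_const
      (Or.inl (hm.trans_le hx).ne')).hasDerivWithinAt)
    (fun x hx => by
      have hx0 : 0 < x := hm.trans_le hx
      rw [norm_mul, Real.norm_eq_abs, abs_neg, abs_of_pos hp, Real.norm_eq_abs,
        abs_of_pos (Real.rpow_pos_of_pos hx0 _)]
      gcongr ?_ * ?_
      exact Real.rpow_le_rpow_of_nonpos hm hx (by linarith)) hs hr
  simpa [Real.norm_eq_abs] using key

section AngularFactor

variable {E : Type*} [NormedAddCommGroup E] [InnerProductSpace ℝ E]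

lemma norm_inv_smul_sub_inv_smul_le {x y : E} (hx : x ≠ 0) (hy : y ≠ 0) :
    ‖‖x‖⁻¹ • x - ‖y‖⁻¹ • y‖ ≤ 2 * ‖x - y‖ / ‖x‖ := by
  have hx' : 0 < ‖x‖ := norm_pos_iff.2 hx
  have hy' : 0 < ‖y‖ := norm_pos_iff.2 hy
  have e : ‖x‖⁻¹ • x - ‖y‖⁻¹ • y = ‖x‖⁻¹ • (x - y) + (‖x‖⁻¹ - ‖y‖⁻¹) • y := by
    rw [smul_sub, sub_smul]; abel
  have e2 : |‖x‖⁻¹ - ‖y‖⁻¹| * ‖y‖ = |‖x‖ - ‖y‖| / ‖x‖ := by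
    have : ‖x‖⁻¹ - ‖y‖⁻¹ = -((‖x‖ - ‖y‖) / (‖x‖ * ‖y‖)) := by field_simp; ring
    rw [this, abs_neg, abs_div, abs_of_pos (mul_pos hx' hy')]
    field_simp
  rw [e]
  refine (norm_add_le _ _).trans ?_
  rw [norm_smul, norm_smul, Real.norm_eq_abs, Real.norm_eq_abs, e2,
    abs_of_pos (inv_pos.2 hx'), inv_mul_eq_div, ← add_div]
  gcongr
  linarith [abs_norm_sub_norm_le x y]

/-- The function `(1 - (u·c)²)(a·u)(b·u)` of a direction `u`. -/
noncomputable def angular (a b c u : E) : ℝ :=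
  (1 - inner ℝ u c ^ 2) * (inner ℝ a u * inner ℝ b u)

lemma abs_inner_le_one {a u : E} (ha : ‖a‖ ≤ 1) (hu : ‖u‖ ≤ 1) : |inner ℝ a u| ≤ 1 :=
  (abs_real_inner_le_norm a u).trans (mul_le_one₀ ha (norm_nonneg _) hu)

lemma abs_one_sub_inner_sq_le_one {c u : E} (hc : ‖c‖ ≤ 1) (hu : ‖u‖ ≤ 1) :
    |1 - inner ℝ u c ^ 2| ≤ 1 := by
  have h := (sq_le_one_iff_abs_le_one _).2 (abs_inner_le_one hu hc)
  rw [abs_le]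
  constructor <;> nlinarith [sq_nonneg (inner ℝ u c)]

lemma abs_angular_le_one {a b c u : E} (ha : ‖a‖ ≤ 1) (hb : ‖b‖ ≤ 1) (hc : ‖c‖ ≤ 1)
    (hu : ‖u‖ ≤ 1) : |angular a b c u| ≤ 1 := by
  rw [angular, abs_mul, abs_mul]
  exact mul_le_one₀ (abs_one_sub_inner_sq_le_one hc hu) (by positivity)
    (mul_le_one₀ (abs_inner_le_one ha hu) (abs_nonneg _) (abs_inner_le_one hb hu))

lemma abs_angular_sub_le {a b c u v : E} (ha : ‖a‖ ≤ 1) (hb : ‖b‖ ≤ 1) (hc : ‖c‖ ≤ 1)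
    (hu : ‖u‖ ≤ 1) (hv : ‖v‖ ≤ 1) :
    |angular a b c u - angular a b c v| ≤ 4 * ‖u - v‖ := by
  have lip : ∀ w : E, ‖w‖ ≤ 1 → |inner ℝ w u - inner ℝ w v| ≤ ‖u - v‖ := fun w hw => by
    rw [← inner_sub_right]
    exact (abs_real_inner_le_norm _ _).trans (mul_le_of_le_one_left (norm_nonneg _) hw)
  have hc1 := abs_inner_le_one hc hu
  have hc2 := abs_inner_le_one hc hv
  have h1 := abs_mul_sub_mul_le hc1 hc2 (lip c hc) (lip c hc)
  have h2 := abs_mul_sub_mul_le (abs_inner_le_one hb hu) (abs_inner_le_one ha hv)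
    (lip a ha) (lip b hb)
  have h3 : |(1 - inner ℝ u c ^ 2) - (1 - inner ℝ v c ^ 2)| ≤ ‖u - v‖ + ‖u - v‖ := by
    rw [real_inner_comm c u, real_inner_comm c v, ← abs_neg]
    convert h1 using 2
    ring
  have h4 : |inner ℝ a u * inner ℝ b u| ≤ 1 := by
    rw [abs_mul]
    exact mul_le_one₀ (abs_inner_le_one ha hu) (abs_nonneg _) (abs_inner_le_one hb hu)
  have := abs_mul_sub_mul_le h4 (abs_one_sub_inner_sq_le_one hc hv) h3 h2
  unfold angular
  linarith

lemma norm_inv_smul_self_le_one (x : E) : ‖‖x‖⁻¹ • x‖ ≤ 1 := by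
  rw [norm_smul, norm_inv, norm_norm]
  exact inv_mul_le_one

lemma abs_rpow_mul_angular_sub_le {p : ℝ} (hp : 0 < p) {a b c x y : E} (ha : ‖a‖ ≤ 1)
    (hb : ‖b‖ ≤ 1) (hc : ‖c‖ ≤ 1) (hx : x ≠ 0) (hxy : ‖x - y‖ ≤ ‖x‖ / 2) :
    |‖x‖ ^ (-p) * angular a b c (‖x‖⁻¹ • x) - ‖y‖ ^ (-p) * angular a b c (‖y‖⁻¹ • y)| ≤
      (p * 2 ^ (p + 1) + 8) * ‖x‖ ^ (-p - 1) * ‖x - y‖ := by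
  have hx' : 0 < ‖x‖ := norm_pos_iff.2 hx
  have hxy' : ‖x‖ / 2 ≤ ‖y‖ := by
    have := norm_sub_norm_le x y
    linarith
  have hy : y ≠ 0 := norm_pos_iff.1 (by linarith)
  set A := angular a b c (‖x‖⁻¹ • x)
  set B := angular a b c (‖y‖⁻¹ • y)
  have e : ‖x‖ ^ (-p) * A - ‖y‖ ^ (-p) * B =
      (‖x‖ ^ (-p) - ‖y‖ ^ (-p)) * B + ‖x‖ ^ (-p) * (A - B) := by ring
  have hB : |B| ≤ 1 := abs_angular_le_one ha hb hc (norm_inv_smul_self_le_one y)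
  have hAB : |A - B| ≤ 4 * (2 * ‖x - y‖ / ‖x‖) :=
    (abs_angular_sub_le ha hb hc (norm_inv_smul_self_le_one x)
      (norm_inv_smul_self_le_one y)).trans
      (by gcongr; exact norm_inv_smul_sub_inv_smul_le hx hy)
  have h1 := abs_rpow_neg_sub_rpow_neg_le hp (half_pos hx') (half_le_self hx'.le) hxy'
  have h2 : (‖x‖ / 2) ^ (-p - 1) = 2 ^ (p + 1) * ‖x‖ ^ (-p - 1) := by
    rw [Real.div_rpow hx'.le zero_le_two, div_eq_mul_inv, ← Real.rpow_neg zero_le_two, mul_comm]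
    congr 2
    ring
  have h3 : ‖x‖ ^ (-p) / ‖x‖ = ‖x‖ ^ (-p - 1) := by
    rw [Real.rpow_sub_one hx'.ne']
  have hpos : 0 < ‖x‖ ^ (-p) := Real.rpow_pos_of_pos hx' _
  rw [e]
  calc |(‖x‖ ^ (-p) - ‖y‖ ^ (-p)) * B + ‖x‖ ^ (-p) * (A - B)|
      ≤ |‖x‖ ^ (-p) - ‖y‖ ^ (-p)| * |B| + ‖x‖ ^ (-p) * |A - B| := by
        refine (abs_add_le _ _).trans_eq ?_
        rw [abs_mul, abs_mul, abs_of_pos hpos]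
    _ ≤ p * (‖x‖ / 2) ^ (-p - 1) * |‖x‖ - ‖y‖| * 1 +
        ‖x‖ ^ (-p) * (4 * (2 * ‖x - y‖ / ‖x‖)) := by gcongr
    _ ≤ p * (‖x‖ / 2) ^ (-p - 1) * ‖x - y‖ * 1 +
        ‖x‖ ^ (-p) * (4 * (2 * ‖x - y‖ / ‖x‖)) := by
        gcongr; exact abs_norm_sub_norm_le x y
    _ = (p * 2 ^ (p + 1) + 8) * ‖x‖ ^ (-p - 1) * ‖x - y‖ := by
        rw [h2, ← h3]; ring

end AngularFactor

section Lattice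

variable {d : ℕ}

lemma rnorm_eq_norm (x : Fin d → ℝ) : rnorm x = ‖WithLp.toLp 2 x‖ := by
  simp [rnorm, EuclideanSpace.norm_eq]

lemma znorm_eq_rnorm (k : Fin d → ℤ) : znorm k = rnorm (fun i => (k i : ℝ)) := rfl

lemma rnorm_nonneg (x : Fin d → ℝ) : 0 ≤ rnorm x := Real.sqrt_nonneg _

lemma continuous_rnorm : Continuous (rnorm : (Fin d → ℝ) → ℝ) := by
  unfold rnorm
  fun_prop

lemma abs_apply_le_rnorm (x : Fin d → ℝ) (i : Fin d) : |x i| ≤ rnorm x :=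
  Real.abs_le_sqrt (Finset.single_le_sum (f := fun j => x j ^ 2)
    (fun _ _ => sq_nonneg _) (Finset.mem_univ i))

lemma rnorm_le_of_forall_abs_le {x : Fin d → ℝ} {m : ℝ} (hm : 0 ≤ m) (h : ∀ i, |x i| ≤ m) :
    rnorm x ≤ d * m := by
  refine Real.sqrt_le_iff.2 ⟨by positivity, ?_⟩
  have h1 : ∑ i, x i ^ 2 ≤ ∑ _i : Fin d, m ^ 2 :=
    Finset.sum_le_sum fun i _ => sq_le_sq.2 ((h i).trans (le_abs_self m))
  rw [Finset.sum_const, Finset.card_univ, Fintype.card_fin, nsmul_eq_mul] at h1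
  have h2 : (d : ℝ) ≤ (d : ℝ) ^ 2 := by exact_mod_cast Nat.le_self_pow two_ne_zero d
  calc _ ≤ (d : ℝ) * m ^ 2 := h1
    _ ≤ (d : ℝ) ^ 2 * m ^ 2 := by gcongr
    _ = _ := by ring

lemma one_le_znorm {k : Fin d → ℤ} (hk : k ≠ 0) : 1 ≤ znorm k := by
  obtain ⟨i, hi⟩ := Function.ne_iff.1 hk
  have h : (1 : ℝ) ≤ |(k i : ℝ)| := by exact_mod_cast Int.one_le_abs hi
  exact h.trans (abs_apply_le_rnorm (fun i => (k i : ℝ)) i)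

lemma one_le_znorm_iff {k : Fin d → ℤ} : 1 ≤ znorm k ↔ k ≠ 0 := by
  refine ⟨?_, one_le_znorm⟩
  rintro h rfl
  simp [znorm] at h
  linarith

lemma finite_setOf_znorm_le (R : ℕ) : {k : Fin d → ℤ | znorm k ≤ R}.Finite := by
  refine (Set.finite_Icc (fun _ => -(R : ℤ)) (fun _ => (R : ℤ))).subset fun k hk => ?_
  have h : ∀ i, |k i| ≤ (R : ℤ) := fun i => by
    have := (abs_apply_le_rnorm (fun i => (k i : ℝ)) i).trans hk
    exact_mod_cast this
  exact ⟨fun i => (abs_le.1 (h i)).1, fun i => (abs_le.1 (h i)).2⟩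

/-- The coordinatewise integer part of a point of `ℝ^d`. -/
noncomputable def latticeFloor (x : Fin d → ℝ) : Fin d → ℤ := fun i => ⌊x i⌋

lemma rnorm_floor_sub_le (x : Fin d → ℝ) :
    rnorm ((fun i => (latticeFloor x i : ℝ)) - x) ≤ d := by
  have := rnorm_le_of_forall_abs_le (x := (fun i => (latticeFloor x i : ℝ)) - x)
    zero_le_one fun i => by
      rw [Pi.sub_apply, abs_sub_comm, latticeFloor, ← Int.fract, abs_of_nonneg (Int.fract_nonneg _)]
      exact (Int.fract_lt_one _).le
  simpa using this

lemma abs_rnorm_sub_rnorm_le (x y : Fin d → ℝ) : |rnorm x - rnorm y| ≤ rnorm (x - y) := by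
  simp only [rnorm_eq_norm, WithLp.toLp_sub]
  exact abs_norm_sub_norm_le _ _

/-- The half-open unit cube with lower corner `k`. -/
def latticeCube (k : Fin d → ℤ) : Set (Fin d → ℝ) :=
  Set.univ.pi fun i => Set.Ico (k i : ℝ) (k i + 1)

lemma mem_latticeCube {x : Fin d → ℝ} {k : Fin d → ℤ} :
    x ∈ latticeCube k ↔ latticeFloor x = k := by
  simp only [latticeCube, Set.mem_pi, Set.mem_univ, true_imp_iff, Set.mem_Ico, funext_iff,
    latticeFloor, Int.floor_eq_iff]

lemma measurableSet_latticeCube (k : Fin d → ℤ) : MeasurableSet (latticeCube k) :=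
  MeasurableSet.univ_pi fun _ => measurableSet_Ico

lemma volume_latticeCube (k : Fin d → ℤ) : volume (latticeCube k) = 1 := by
  simp [latticeCube, Real.volume_pi_Ico]

lemma comp_latticeFloor_eq_sum {φ : (Fin d → ℤ) → ℝ} {s : Finset (Fin d → ℤ)}
    (hs : ∀ k ∉ s, φ k = 0) (x : Fin d → ℝ) :
    φ (latticeFloor x) = ∑ k ∈ s, (latticeCube k).indicator (fun _ => φ k) x := by
  by_cases h : latticeFloor x ∈ s
  · rw [Finset.sum_eq_single_of_mem _ h]
    · rw [Set.indicator_of_mem (mem_latticeCube.2 rfl)]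
    · intro k _ hk
      exact Set.indicator_of_notMem (fun h' => hk (mem_latticeCube.1 h').symm) _
  · rw [hs _ h, Finset.sum_eq_zero]
    intro k hk
    refine Set.indicator_of_notMem (fun h' => h ?_) _
    rwa [mem_latticeCube.1 h']

lemma integrable_indicator_latticeCube (k : Fin d → ℤ) (c : ℝ) :
    Integrable ((latticeCube k).indicator fun _ => c) := by
  refine (integrable_indicator_iff (measurableSet_latticeCube k)).2 (integrableOn_const ?_)
  simp [volume_latticeCube]

lemma integrable_comp_latticeFloor {φ : (Fin d → ℤ) → ℝ} (hφ : φ.support.Finite) :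
    Integrable fun x => φ (latticeFloor x) := by
  have h := comp_latticeFloor_eq_sum (φ := φ) (s := hφ.toFinset) (by simp)
  simp_rw [h]
  exact integrable_finsetSum _ fun k _ => integrable_indicator_latticeCube k _

lemma integral_comp_latticeFloor {φ : (Fin d → ℤ) → ℝ} (hφ : φ.support.Finite) :
    ∫ x, φ (latticeFloor x) = ∑' k, φ k := by
  have h := comp_latticeFloor_eq_sum (φ := φ) (s := hφ.toFinset) (by simp)
  simp_rw [h]
  rw [integral_finsetSum _ fun k _ => integrable_indicator_latticeCube k _,
    tsum_eq_sum (s := hφ.toFinset) (by simp)]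
  refine Finset.sum_congr rfl fun k _ => ?_
  rw [integral_indicator_const _ (measurableSet_latticeCube k)]
  simp [Measure.real, volume_latticeCube]

lemma measurableSet_rnorm_le (R : ℝ) : MeasurableSet {x : Fin d → ℝ | rnorm x ≤ R} :=
  (isClosed_le continuous_rnorm continuous_const).measurableSet

lemma volume_rnorm_le {R : ℝ} (hR : 0 ≤ R) :
    volume {x : Fin d → ℝ | rnorm x ≤ R} =
      ENNReal.ofReal (R ^ d) * volume (Metric.ball (0 : EuclideanSpace ℝ (Fin d)) 1) := by
  have h := Measure.addHaar_closedBall (volume : Measure (EuclideanSpace ℝ (Fin d))) 0 hR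
  rw [finrank_euclideanSpace_fin] at h
  rw [← h, ← (PiLp.volume_preserving_toLp (Fin d)).measure_preimage
    Metric.isClosed_closedBall.measurableSet.nullMeasurableSet]
  congr 1
  ext x
  simp [rnorm_eq_norm]

lemma volume_rnorm_le_ne_top (R : ℝ) : volume {x : Fin d → ℝ | rnorm x ≤ R} ≠ ⊤ := by
  refine ne_top_of_le_ne_top ?_ (measure_mono
    (fun x (hx : rnorm x ≤ R) => hx.trans (le_max_left R 0)))
  exact (volume_rnorm_le (le_max_right R 0)).trans_ne
    (ENNReal.mul_ne_top ENNReal.ofReal_ne_top measure_ball_lt_top.ne)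

lemma volume_real_rnorm_le {R : ℝ} (hR : 0 ≤ R) :
    volume.real {x : Fin d → ℝ | rnorm x ≤ R} =
      R ^ d * volume.real (Metric.ball (0 : EuclideanSpace ℝ (Fin d)) 1) := by
  rw [Measure.real, volume_rnorm_le hR, ENNReal.toReal_mul,
    ENNReal.toReal_ofReal (by positivity), Measure.real]

/-- The points whose Euclidean norm is within `d` of `N`, the lower bound being strict. -/
def shell (d N : ℕ) : Set (Fin d → ℝ) :=
  {x | rnorm x ≤ N + d} \ {x | rnorm x ≤ max ((N : ℝ) - d) 0}

lemma measurableSet_shell (N : ℕ) : MeasurableSet (shell d N) :=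
  (measurableSet_rnorm_le _).diff (measurableSet_rnorm_le _)

lemma volume_shell_ne_top (N : ℕ) : volume (shell d N) ≠ ⊤ :=
  ne_top_of_le_ne_top (volume_rnorm_le_ne_top _) (measure_mono Set.sdiff_subset)

lemma volume_real_shell_le {N : ℕ} (hN : 1 ≤ N) :
    volume.real (shell d N) ≤
      2 * d * d * (1 + d) ^ (d - 1) *
        volume.real (Metric.ball (0 : EuclideanSpace ℝ (Fin d)) 1) * (N : ℝ) ^ (d - 1) := by
  have hN' : (1 : ℝ) ≤ N := by exact_mod_cast hN
  have hd : (0 : ℝ) ≤ d := Nat.cast_nonneg d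
  set b := max ((N : ℝ) - d) 0 with hb
  have hb0 : 0 ≤ b := le_max_right _ _
  have hba : b ≤ N + d := max_le (by linarith) (by linarith)
  have hab : (N : ℝ) + d - b ≤ 2 * d := by linarith [le_max_left ((N : ℝ) - d) 0]
  have hsub : {x : Fin d → ℝ | rnorm x ≤ b} ⊆ {x | rnorm x ≤ N + d} :=
    fun x (hx : rnorm x ≤ b) => hx.trans hba
  rw [shell, ← hb, measureReal_sdiff hsub
    (measurableSet_rnorm_le _) (volume_rnorm_le_ne_top _),
    volume_real_rnorm_le (by positivity), volume_real_rnorm_le hb0, ← sub_mul]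
  have h := (le_abs_self _).trans (abs_pow_sub_pow_le ((N : ℝ) + d) b d)
  rw [abs_of_nonneg (by linarith : 0 ≤ (N : ℝ) + d - b), abs_of_nonneg hb0,
    abs_of_nonneg (by positivity : 0 ≤ (N : ℝ) + d), max_eq_left hba] at h
  have h2 : ((N : ℝ) + d) ^ d - b ^ d ≤ 2 * d * d * ((1 + d) * N) ^ (d - 1) := by
    refine h.trans ?_
    gcongr
    nlinarith
  rw [mul_pow] at h2
  calc _ ≤ (2 * d * d * ((1 + d) ^ (d - 1) * (N : ℝ) ^ (d - 1))) *
        volume.real (Metric.ball (0 : EuclideanSpace ℝ (Fin d)) 1) := by gcongr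
    _ = _ := by ring

end Lattice

section RiemannSum

variable {d : ℕ}

/-- The integrand `|x|^{-2γ} sin²(∠_{x,l}) (a·x)(b·x)/|x|²`. -/
noncomputable def kern (γ : ℝ) (l : Fin d → ℤ) (a b x : Fin d → ℝ) : ℝ :=
  rnorm x ^ (-(2 : ℝ) * γ) * sin2R x l * ((∑ i, a i * x i) * (∑ i, b i * x i) / rnorm x ^ 2)

/-- The annulus `1 ≤ |x| ≤ N`. -/
def annulus (d N : ℕ) : Set (Fin d → ℝ) := {x | 1 ≤ rnorm x ∧ rnorm x ≤ N}

/-- The sum of `|k|^{-2γ-1}` over the nonzero lattice points with `|k| ≤ N`. -/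
noncomputable def latticeSum (d : ℕ) (γ : ℝ) (N : ℕ) : ℝ :=
  ∑' k : Fin d → ℤ, if k ≠ 0 ∧ znorm k ≤ N then znorm k ^ (-(2 : ℝ) * γ - 1) else 0

lemma kern_eq (γ : ℝ) (l : Fin d → ℤ) (a b x : Fin d → ℝ) :
    kern γ l a b x = ‖WithLp.toLp 2 x‖ ^ (-(2 * γ)) *
      angular (WithLp.toLp 2 a) (WithLp.toLp 2 b)
        ((znorm l)⁻¹ • WithLp.toLp 2 (fun i => (l i : ℝ)))
        (‖WithLp.toLp 2 x‖⁻¹ • WithLp.toLp 2 x) := by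
  have h : ∀ u v : Fin d → ℝ,
      inner ℝ (WithLp.toLp 2 u) (WithLp.toLp 2 v) = ∑ i, u i * v i := fun u v => by
    simp [PiLp.inner_apply, mul_comm]
  simp only [kern, sin2R, angular, real_inner_smul_left, real_inner_smul_right]
  simp only [h, ← rnorm_eq_norm, neg_mul]
  ring

lemma measurable_kern (γ : ℝ) (l : Fin d → ℤ) (a b : Fin d → ℝ) :
    Measurable (kern γ l a b) := by
  have h : Measurable (rnorm : (Fin d → ℝ) → ℝ) := continuous_rnorm.measurable
  unfold kern sin2R
  fun_prop

lemma measurableSet_annulus (N : ℕ) : MeasurableSet (annulus d N) :=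
  ((isClosed_le continuous_const continuous_rnorm).inter
    (isClosed_le continuous_rnorm continuous_const)).measurableSet

lemma norm_toLp_le_one {a : Fin d → ℝ} (ha : ∑ i, a i ^ 2 = 1) : ‖WithLp.toLp 2 a‖ ≤ 1 := by
  rw [← rnorm_eq_norm, rnorm, ha, Real.sqrt_one]

lemma norm_znorm_inv_smul_le_one (l : Fin d → ℤ) :
    ‖(znorm l)⁻¹ • WithLp.toLp 2 (fun i => (l i : ℝ))‖ ≤ 1 := by
  rw [znorm_eq_rnorm, rnorm_eq_norm]
  exact norm_inv_smul_self_le_one _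

lemma abs_kern_le {γ : ℝ} (l : Fin d → ℤ) {a b : Fin d → ℝ} (ha : ∑ i, a i ^ 2 = 1)
    (hb : ∑ i, b i ^ 2 = 1) (x : Fin d → ℝ) :
    |kern γ l a b x| ≤ rnorm x ^ (-(2 * γ)) := by
  have h0 : 0 ≤ rnorm x ^ (-(2 * γ)) := Real.rpow_nonneg (rnorm_nonneg x) _
  rw [kern_eq, abs_mul, ← rnorm_eq_norm, abs_of_nonneg h0]
  refine mul_le_of_le_one_right h0 (abs_angular_le_one (norm_toLp_le_one ha)
    (norm_toLp_le_one hb) (norm_znorm_inv_smul_le_one l) ?_)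
  rw [rnorm_eq_norm]
  exact norm_inv_smul_self_le_one _

lemma abs_kern_sub_le {γ : ℝ} (hγ : 0 < γ) (l : Fin d → ℤ) {a b : Fin d → ℝ}
    (ha : ∑ i, a i ^ 2 = 1) (hb : ∑ i, b i ^ 2 = 1) {x y : Fin d → ℝ} (hx : 0 < rnorm x)
    (hxy : rnorm (x - y) ≤ rnorm x / 2) :
    |kern γ l a b x - kern γ l a b y| ≤
      (2 * γ * 2 ^ (2 * γ + 1) + 8) * rnorm x ^ (-(2 : ℝ) * γ - 1) * rnorm (x - y) := by
  simp only [rnorm_eq_norm, WithLp.toLp_sub] at hx hxy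
  have := abs_rpow_mul_angular_sub_le (p := 2 * γ) (by linarith) (norm_toLp_le_one ha)
    (norm_toLp_le_one hb) (norm_znorm_inv_smul_le_one l) (norm_pos_iff.1 hx) hxy
  simpa only [kern_eq, rnorm_eq_norm, WithLp.toLp_sub, neg_mul] using this

lemma abs_indicator_kern_le_one {γ : ℝ} (hγ : 0 < γ) (l : Fin d → ℤ) {a b : Fin d → ℝ}
    (ha : ∑ i, a i ^ 2 = 1) (hb : ∑ i, b i ^ 2 = 1) (N : ℕ) (x : Fin d → ℝ) :
    |(annulus d N).indicator (kern γ l a b) x| ≤ 1 := by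
  by_cases hx : x ∈ annulus d N
  · rw [Set.indicator_of_mem hx]
    exact (abs_kern_le l ha hb x).trans
      (Real.rpow_le_one_of_one_le_of_nonpos hx.1 (by linarith))
  · simp [Set.indicator_of_notMem hx]

lemma integrable_indicator_kern {γ : ℝ} (hγ : 0 < γ) (l : Fin d → ℤ) {a b : Fin d → ℝ}
    (ha : ∑ i, a i ^ 2 = 1) (hb : ∑ i, b i ^ 2 = 1) (N : ℕ) :
    Integrable ((annulus d N).indicator (kern γ l a b)) := by
  refine (integrable_indicator_iff (measurableSet_annulus N)).2
    (Measure.integrableOn_of_bounded (M := 1) ?_ (measurable_kern γ l a b).aestronglyMeasurable ?_)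
  · exact ne_top_of_le_ne_top (volume_rnorm_le_ne_top (N : ℝ)) (measure_mono fun x hx => hx.2)
  · refine (ae_restrict_iff' (measurableSet_annulus N)).2 (Filter.Eventually.of_forall ?_)
    intro x hx
    have := abs_indicator_kern_le_one hγ l ha hb N x
    rwa [Set.indicator_of_mem hx] at this

lemma finite_support_latticeSum (γ : ℝ) (N : ℕ) :
    (Function.support fun k : Fin d → ℤ =>
      if k ≠ 0 ∧ znorm k ≤ N then znorm k ^ (-(2 : ℝ) * γ - 1) else 0).Finite := by
  refine (finite_setOf_znorm_le N).subset fun k hk => ?_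
  by_contra h
  exact hk (if_neg fun h' => h h'.2)

lemma finite_support_indicator_kern (γ : ℝ) (l : Fin d → ℤ) (a b : Fin d → ℝ) (N : ℕ) :
    (Function.support fun k : Fin d → ℤ =>
      (annulus d N).indicator (kern γ l a b) (fun i => (k i : ℝ))).Finite := by
  refine (finite_setOf_znorm_le N).subset fun k hk => ?_
  by_contra h
  exact hk (Set.indicator_of_notMem (fun h' => h h'.2) _)

lemma summable_latticeSum (γ : ℝ) (N : ℕ) :
    Summable fun k : Fin d → ℤ =>
      if k ≠ 0 ∧ znorm k ≤ N then znorm k ^ (-(2 : ℝ) * γ - 1) else 0 :=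
  summable_of_hasFiniteSupport (finite_support_latticeSum γ N)

lemma latticeSum_term_nonneg (γ : ℝ) (N : ℕ) (k : Fin d → ℤ) :
    0 ≤ if k ≠ 0 ∧ znorm k ≤ N then znorm k ^ (-(2 : ℝ) * γ - 1) else 0 := by
  split_ifs
  · exact Real.rpow_nonneg (Real.sqrt_nonneg _) _
  · exact le_rfl

lemma one_le_latticeSum (hd : 1 ≤ d) (γ : ℝ) {N : ℕ} (hN : 1 ≤ N) : 1 ≤ latticeSum d γ N := by
  have h := (summable_latticeSum (d := d) γ N).le_tsum (Pi.single ⟨0, hd⟩ 1) fun k _ => latticeSum_term_nonneg γ N k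
  have hn : znorm (Pi.single (⟨0, hd⟩ : Fin d) (1 : ℤ)) = 1 := by
    rw [znorm, Finset.sum_eq_single ⟨0, hd⟩] <;> simp +contextual
  have hN' : (1 : ℝ) ≤ N := by exact_mod_cast hN
  rw [if_pos ⟨one_le_znorm_iff.1 hn.ge, hn.trans_le hN'⟩, hn, Real.one_rpow] at h
  exact h

lemma rpow_mul_pow_le_latticeSum (hd : 1 ≤ d) {γ : ℝ} (hγ : 0 < γ) {N : ℕ} (hN : 1 ≤ N) :
    (N : ℝ) ^ (-(2 * γ)) * (N : ℝ) ^ (d - 1) ≤ 2 * (d : ℝ) ^ d * latticeSum d γ N := by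
  have hN' : (1 : ℝ) ≤ N := by exact_mod_cast hN
  obtain ⟨m, hm1, hm2⟩ : ∃ m : ℕ, d * m ≤ N ∧ N ≤ d * (m + 1) :=
    ⟨N / d, Nat.mul_div_le N d, (Nat.lt_mul_div_succ N hd).le⟩
  set φ : (Fin d → ℤ) → ℝ := fun k =>
    if k ≠ 0 ∧ znorm k ≤ N then znorm k ^ (-(2 : ℝ) * γ - 1) else 0 with hφ
  set s : Finset (Fin d → ℤ) := Finset.Icc 0 (fun _ => (m : ℤ)) with hs
  have hterm : ∀ k ∈ s, (N : ℝ) ^ (-(2 : ℝ) * γ - 1) ≤ φ k + if k = 0 then 1 else 0 := by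
    intro k hk
    rw [hs, Finset.mem_Icc] at hk
    by_cases hk0 : k = 0
    · have : (N : ℝ) ^ (-(2 : ℝ) * γ - 1) ≤ 1 :=
        Real.rpow_le_one_of_one_le_of_nonpos hN' (by linarith)
      simpa [hφ, hk0] using this
    · have hle : znorm k ≤ N := by
        have h1 : znorm k ≤ d * (m : ℝ) := by
          refine rnorm_le_of_forall_abs_le (by positivity) fun i => ?_
          have h2 : (0 : ℤ) ≤ k i := hk.1 i
          have h3 : k i ≤ (m : ℤ) := hk.2 i
          rw [abs_of_nonneg (by exact_mod_cast h2)]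
          exact_mod_cast h3
        refine h1.trans ?_
        exact_mod_cast hm1
      simp only [hφ, if_pos (And.intro hk0 hle), hk0, if_false, add_zero, ne_eq]
      exact Real.rpow_le_rpow_of_nonpos (zero_lt_one.trans_le (one_le_znorm hk0)) hle
        (by linarith)
  have hcard : (s.card : ℝ) = ((m : ℝ) + 1) ^ d := by
    rw [hs, Pi.card_Icc]
    simp
  have hsum := Finset.sum_le_sum hterm
  rw [Finset.sum_const, nsmul_eq_mul, hcard, Finset.sum_add_distrib, Finset.sum_ite_eq'] at hsum
  have h1 : ∑ k ∈ s, φ k ≤ latticeSum d γ N :=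
    (summable_latticeSum γ N).sum_le_tsum s
      fun k _ => latticeSum_term_nonneg γ N k
  have h2 : (if (0 : Fin d → ℤ) ∈ s then (1 : ℝ) else 0) ≤ latticeSum d γ N := by
    refine le_trans ?_ (one_le_latticeSum hd γ hN)
    split_ifs <;> norm_num
  have h3 : (N : ℝ) ≤ d * ((m : ℝ) + 1) := by
    exact_mod_cast hm2
  have h4 : (N : ℝ) ^ d ≤ (d : ℝ) ^ d * ((m : ℝ) + 1) ^ d := by
    rw [← mul_pow]
    gcongr
  have h5 : (N : ℝ) ^ (-(2 * γ)) * (N : ℝ) ^ (d - 1) =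
      (N : ℝ) ^ d * (N : ℝ) ^ (-(2 : ℝ) * γ - 1) := by
    have hN0 : (N : ℝ) ≠ 0 := by positivity
    rw [Real.rpow_sub_one hN0, neg_mul]
    obtain ⟨m, rfl⟩ : ∃ m, d = m + 1 := ⟨d - 1, by omega⟩
    rw [Nat.add_sub_cancel, pow_succ]
    field_simp
  rw [h5]
  calc (N : ℝ) ^ d * (N : ℝ) ^ (-(2 : ℝ) * γ - 1)
      ≤ (d : ℝ) ^ d * ((m : ℝ) + 1) ^ d * (N : ℝ) ^ (-(2 : ℝ) * γ - 1) := by gcongr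
    _ = (d : ℝ) ^ d * (((m : ℝ) + 1) ^ d * (N : ℝ) ^ (-(2 : ℝ) * γ - 1)) := by ring
    _ ≤ (d : ℝ) ^ d * (latticeSum d γ N + latticeSum d γ N) := by gcongr; linarith
    _ = _ := by ring

lemma abs_indicator_kern_floor_sub_le (hd : 1 ≤ d) {γ : ℝ} (hγ : 0 < γ) (l : Fin d → ℤ)
    {a b : Fin d → ℝ} (ha : ∑ i, a i ^ 2 = 1) (hb : ∑ i, b i ^ 2 = 1) (N : ℕ)
    (x : Fin d → ℝ) :
    |(annulus d N).indicator (kern γ l a b) (fun i => (latticeFloor x i : ℝ)) -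
        (annulus d N).indicator (kern γ l a b) x| ≤
      {x | rnorm x ≤ 9 * d}.indicator (fun _ => (2 : ℝ)) x +
      ((2 * γ * 2 ^ (2 * γ + 1) + 8) * d) *
        (if latticeFloor x ≠ 0 ∧ znorm (latticeFloor x) ≤ N then
          znorm (latticeFloor x) ^ (-(2 : ℝ) * γ - 1) else 0) +
      (shell d N).indicator (fun _ => ((N : ℝ) / 2) ^ (-(2 * γ))) x := by
  have hd' : (1 : ℝ) ≤ d := by exact_mod_cast hd
  set q : Fin d → ℝ := fun i => (latticeFloor x i : ℝ) with hq
  have hqx : rnorm (q - x) ≤ d := rnorm_floor_sub_le x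
  have habs := abs_le.1 ((abs_rnorm_sub_rnorm_le q x).trans hqx)
  have hT2 := latticeSum_term_nonneg γ N (latticeFloor x)
  have hC : 0 ≤ (2 * γ * 2 ^ (2 * γ + 1) + 8) * d := by positivity
  have hT2' := mul_nonneg hC hT2
  have hT3 : 0 ≤ (shell d N).indicator (fun _ => ((N : ℝ) / 2) ^ (-(2 * γ))) x :=
    Set.indicator_nonneg (fun _ _ => by positivity) _
  by_cases hx : rnorm x ≤ 9 * d
  · have h1 := abs_indicator_kern_le_one hγ l ha hb N q
    have h2 := abs_indicator_kern_le_one hγ l ha hb N x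
    rw [Set.indicator_of_mem (s := {x | rnorm x ≤ 9 * d}) hx]
    linarith [abs_sub ((annulus d N).indicator (kern γ l a b) q)
      ((annulus d N).indicator (kern γ l a b) x)]
  rw [Set.indicator_of_notMem (s := {x | rnorm x ≤ 9 * d}) hx, zero_add]
  push Not at hx
  have edge : ∀ y : Fin d → ℝ, y ∈ annulus d N → (N : ℝ) - d < rnorm y → 8 * d < rnorm y →
      |kern γ l a b y| ≤ ((N : ℝ) / 2) ^ (-(2 * γ)) := fun y hy h1 h2 => by
    refine (abs_kern_le l ha hb y).trans (Real.rpow_le_rpow_of_nonpos ?_ ?_ (by linarith)) <;>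
    linarith [hy.2]
  have mem_shell : (N : ℝ) - d < rnorm x → rnorm x ≤ N + d → x ∈ shell d N :=
    fun h1 h2 => ⟨h2, not_le.2 (max_lt h1 (by linarith))⟩
  by_cases hqA : q ∈ annulus d N <;> by_cases hxA : x ∈ annulus d N
  · rw [Set.indicator_of_mem hqA, Set.indicator_of_mem hxA]
    have hlip := abs_kern_sub_le hγ l ha hb (x := q) (y := x) (by linarith) (by linarith)
    rw [if_pos ⟨one_le_znorm_iff.1 hqA.1, hqA.2⟩]
    have : (2 * γ * 2 ^ (2 * γ + 1) + 8) * rnorm q ^ (-(2 : ℝ) * γ - 1) * rnorm (q - x) ≤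
        (2 * γ * 2 ^ (2 * γ + 1) + 8) * rnorm q ^ (-(2 : ℝ) * γ - 1) * d := by
      have := Real.rpow_nonneg (rnorm_nonneg q) (-(2 : ℝ) * γ - 1)
      gcongr
    rw [znorm_eq_rnorm, ← hq]
    linarith
  · have hxN : (N : ℝ) < rnorm x := by
      by_contra! h
      exact hxA ⟨by linarith, h⟩
    have hxs := mem_shell (by linarith) (by linarith [hqA.2])
    rw [Set.indicator_of_mem hqA, Set.indicator_of_notMem hxA, sub_zero,
      Set.indicator_of_mem hxs]
    linarith [edge q hqA (by linarith) (by linarith)]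
  · have hqN : (N : ℝ) < rnorm q := by
      by_contra! h
      exact hqA ⟨by linarith, h⟩
    have hxs := mem_shell (by linarith) (by linarith [hxA.2])
    rw [Set.indicator_of_notMem hqA, Set.indicator_of_mem hxA, zero_sub, abs_neg,
      Set.indicator_of_mem hxs]
    linarith [edge x hxA (by linarith) (by linarith)]
  · rw [Set.indicator_of_notMem hqA, Set.indicator_of_notMem hxA, sub_zero, abs_zero]
    linarith

lemma exists_abs_tsum_sub_integral_le (hd : 1 ≤ d) {γ : ℝ} (hγ : 0 < γ) :
    ∃ C : ℝ, 0 < C ∧ ∀ N : ℕ, 1 ≤ N → ∀ (l : Fin d → ℤ) (a b : Fin d → ℝ),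
      ∑ i, a i ^ 2 = 1 → ∑ i, b i ^ 2 = 1 →
      |(∑' k : Fin d → ℤ, (annulus d N).indicator (kern γ l a b) (fun i => (k i : ℝ))) -
        ∫ x in annulus d N, kern γ l a b x| ≤ C * latticeSum d γ N := by
  set V := volume.real (Metric.ball (0 : EuclideanSpace ℝ (Fin d)) 1)
  set B := volume.real {x : Fin d → ℝ | rnorm x ≤ 9 * d}
  set K := (2 * γ * 2 ^ (2 * γ + 1) + 8) * d
  set K' := (2 : ℝ) ^ (2 * γ) * (2 * d * d * (1 + d) ^ (d - 1) * V) with hK'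
  have hd0 : (0 : ℝ) < d := by exact_mod_cast hd
  have hV : 0 ≤ V := measureReal_nonneg
  have hB : 0 ≤ B := measureReal_nonneg
  have hKpos : 0 < K := by positivity
  have hK'0 : 0 ≤ K' := by positivity
  refine ⟨B * 2 + K + K' * (2 * (d : ℝ) ^ d), by positivity, ?_⟩
  intro N hN l a b ha hb
  have hN0 : (0 : ℝ) < N := by exact_mod_cast hN
  have hfin := finite_support_indicator_kern γ l a b N
  have hfin' := finite_support_latticeSum (d := d) γ N
  have i1 : Integrable ({x : Fin d → ℝ | rnorm x ≤ 9 * d}.indicator fun _ => (2 : ℝ)) :=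
    (integrable_indicator_iff (measurableSet_rnorm_le _)).2
      (integrableOn_const (volume_rnorm_le_ne_top _))
  have i2 := (integrable_comp_latticeFloor hfin').const_mul K
  have i3 : Integrable ((shell d N).indicator fun _ => ((N : ℝ) / 2) ^ (-(2 * γ))) :=
    (integrable_indicator_iff (measurableSet_shell N)).2
      (integrableOn_const (volume_shell_ne_top N))
  have key := norm_integral_le_of_norm_le
    (f := fun x => (annulus d N).indicator (kern γ l a b) (fun i => (latticeFloor x i : ℝ)) -
      (annulus d N).indicator (kern γ l a b) x) ((i1.add i2).add i3)
    (Filter.Eventually.of_forall (abs_indicator_kern_floor_sub_le hd hγ l ha hb N))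
  rw [integral_sub (integrable_comp_latticeFloor hfin) (integrable_indicator_kern hγ l ha hb N),
    integral_comp_latticeFloor hfin, integral_indicator (measurableSet_annulus N),
    Real.norm_eq_abs] at key
  refine key.trans ?_
  rw [integral_add' (i1.add i2) i3, integral_add' i1 i2, integral_const_mul,
    integral_comp_latticeFloor hfin', integral_indicator_const _ (measurableSet_rnorm_le _),
    integral_indicator_const _ (measurableSet_shell N), smul_eq_mul, smul_eq_mul]
  change B * 2 + K * latticeSum d γ N + _ ≤ _
  have hS := one_le_latticeSum hd γ hN
  have h1 : ((N : ℝ) / 2) ^ (-(2 * γ)) = 2 ^ (2 * γ) * (N : ℝ) ^ (-(2 * γ)) := by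
    rw [Real.div_rpow hN0.le zero_le_two, Real.rpow_neg zero_le_two, div_inv_eq_mul, mul_comm]
  have h2 : volume.real (shell d N) * ((N : ℝ) / 2) ^ (-(2 * γ)) ≤
      K' * (2 * (d : ℝ) ^ d * latticeSum d γ N) := by
    calc _ ≤ (2 * d * d * (1 + d) ^ (d - 1) * V * (N : ℝ) ^ (d - 1)) *
          ((N : ℝ) / 2) ^ (-(2 * γ)) := by
          gcongr
          exact volume_real_shell_le hN
      _ = K' * ((N : ℝ) ^ (-(2 * γ)) * (N : ℝ) ^ (d - 1)) := by rw [h1, hK']; ring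
      _ ≤ _ := mul_le_mul_of_nonneg_left (rpow_mul_pow_le_latticeSum hd hγ hN) hK'0
  have h3 : B * 2 ≤ B * 2 * latticeSum d γ N := le_mul_of_one_le_right (by positivity) hS
  linarith

end RiemannSum

lemma epsN_nonneg (d : ℕ) (γ : ℝ) (N : ℕ) : 0 ≤ epsN d γ N := by
  refine inv_nonneg.2 (tsum_nonneg fun k => ?_)
  split_ifs
  · exact Real.rpow_nonneg (Real.sqrt_nonneg _) _
  · exact le_rfl

lemma thetaN_sq_mul_eq {d : ℕ} (γ : ℝ) (N : ℕ) (l k : Fin d → ℤ) (a b : Fin d → ℝ) :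
    thetaN d γ N k ^ 2 * sin2 k l * (rdot a k * rdot b k / znorm k ^ 2) =
      epsN d γ N * (annulus d N).indicator (kern γ l a b) (fun i => (k i : ℝ)) := by
  by_cases h : 1 ≤ znorm k ∧ znorm k ≤ N
  · have hmem : (fun i => (k i : ℝ)) ∈ annulus d N := h
    have h0 : 0 < znorm k := zero_lt_one.trans_le h.1
    have hp : (znorm k ^ (-γ)) ^ 2 = znorm k ^ (-(2 : ℝ) * γ) := by
      rw [← Real.rpow_natCast, ← Real.rpow_mul h0.le]
      congr 1
      push_cast
      ring
    rw [Set.indicator_of_mem hmem, thetaN, if_pos h, mul_pow, Real.sq_sqrt (epsN_nonneg d γ N), hp]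
    simp only [kern, sin2, sin2R, rdot, zdot, znorm_eq_rnorm]
    ring
  · have hmem : (fun i => (k i : ℝ)) ∉ annulus d N := h
    rw [Set.indicator_of_notMem hmem, thetaN, if_neg h]
    ring

/-- `|∑_k (θ^N_k)² sin²(∠_{k,l}) (a·k)(b·k)/|k|²
 - ε_N ∫_{1 ≤ |x| ≤ N} |x|^{-2γ} sin²(∠_{x,l}) (a·x)(b·x)/|x|² dx| ≤ C D_N`,
uniformly in `N ≥ 1`, `l ∈ ℤ^d₀` and unit vectors `a, b`. -/
theorem stmt13 {d : ℕ} (hd : 2 ≤ d) (γ : ℝ) (hγ : 0 < γ ∧ γ < d / 2) :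
    ∃ C : ℝ, 0 < C ∧ ∀ N : ℕ, 1 ≤ N → ∀ l : Fin d → ℤ, l ≠ 0 →
      ∀ a b : Fin d → ℝ, (∑ i, a i ^ 2 = 1) → (∑ i, b i ^ 2 = 1) →
      |(∑' k : Fin d → ℤ,
          thetaN d γ N k ^ 2 * sin2 k l * (rdot a k * rdot b k / znorm k ^ 2)) -
          epsN d γ N *
            ∫ x in {x : Fin d → ℝ | 1 ≤ rnorm x ∧ rnorm x ≤ N},
              rnorm x ^ (-(2 : ℝ) * γ) * sin2R x l *
                ((∑ i, a i * x i) * (∑ i, b i * x i) / rnorm x ^ 2)| ≤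
        C * DN d γ N := by
  obtain ⟨C, hC, h⟩ := exists_abs_tsum_sub_integral_le (one_le_two.trans hd) hγ.1
  refine ⟨C, hC, fun N hN l _ a b ha hb => ?_⟩
  have hsum := h N hN l a b ha hb
  simp only [thetaN_sq_mul_eq]
  rw [tsum_mul_left]
  change |_ - epsN d γ N * ∫ x in annulus d N, kern γ l a b x| ≤
    C * (epsN d γ N * latticeSum d γ N)
  rw [← mul_sub, abs_mul, abs_of_nonneg (epsN_nonneg d γ N)]
  calc _ ≤ epsN d γ N * (C * latticeSum d γ N) := by
        gcongr
        exact epsN_nonneg d γ N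
    _ = _ := by ring
end

section
/- Let γ ∈ (0, 3/2), let l ∈ ℝ³ be a nonzero vector, and let a, b ∈ ℝ³ be unit vectors orthogonal to l. Then for every N ≥ 1: if a = b, then ∫_{1 ≤ |x| ≤ N} |x|^{−2γ−2} (1 − (x·l)²/(|x|²|l|²)) (a·x)(b·x) dx = (16π/15) ∫_1^N r^{2−2γ} dr; and if a·b = 0, then the same integral equals 0. -/
open MeasureTheory

open scoped RealInnerProductSpace

/-- Polar coordinates for a product of a radial function and a function of the direction. -/
theorem integral_radial_mul_angular {E : Type*} [NormedAddCommGroup E] [NormedSpace ℝ E]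
    [MeasurableSpace E] [BorelSpace E] [FiniteDimensional ℝ E] [Nontrivial E]
    (μ : Measure E) [μ.IsAddHaarMeasure] (f : ℝ → ℝ) (h : E → ℝ) :
    ∫ x, f ‖x‖ * h (‖x‖⁻¹ • x) ∂μ =
      (∫ ω : Metric.sphere (0 : E) 1, h ω ∂μ.toSphere) *
        ∫ r in Set.Ioi (0 : ℝ), r ^ (Module.finrank ℝ E - 1) * f r :=
  calc
    ∫ x, f ‖x‖ * h (‖x‖⁻¹ • x) ∂μ
      = ∫ x : ({(0)}ᶜ : Set E), f ‖x.1‖ * h (‖x.1‖⁻¹ • x.1) ∂(μ.comap (↑)) := by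
      rw [integral_subtype_comap (measurableSet_singleton _).compl
        fun x ↦ f ‖x‖ * h (‖x‖⁻¹ • x), restrict_compl_singleton]
    _ = ∫ x, h x.1 * f x.2 ∂μ.toSphere.prod (.volumeIoiPow (Module.finrank ℝ E - 1)) := by
      simpa [mul_comm] using μ.measurePreserving_homeomorphUnitSphereProd.integral_comp
        (Homeomorph.measurableEmbedding _)
        (fun p : Metric.sphere (0 : E) 1 × Set.Ioi (0 : ℝ) ↦ f p.2 * h p.1)
    _ = (∫ ω : Metric.sphere (0 : E) 1, h ω ∂μ.toSphere) *
          ∫ x : Set.Ioi (0 : ℝ), f x ∂.volumeIoiPow (Module.finrank ℝ E - 1) :=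
      integral_prod_mul (fun ω : Metric.sphere (0 : E) 1 ↦ h ω)
        (fun r : Set.Ioi (0 : ℝ) ↦ f r)
    _ = _ := by
      congr 1
      simp only [Measure.volumeIoiPow, ENNReal.ofReal]
      rw [integral_withDensity_eq_integral_smul,
        integral_subtype_comap measurableSet_Ioi
          fun a ↦ Real.toNNReal (a ^ (Module.finrank ℝ E - 1)) • f a,
        setIntegral_congr_fun measurableSet_Ioi fun x hx ↦ ?_]
      · rw [NNReal.smul_def, Real.coe_toNNReal _ (pow_nonneg (le_of_lt hx) _), smul_eq_mul]
      · exact (measurable_subtype_coe.pow_const _).real_toNNReal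

theorem integral_Ioi_pow_mul_exp_neg_sq (k : ℕ) :
    ∫ x in Set.Ioi (0 : ℝ), x ^ k * Real.exp (-x ^ 2) = 1 / 2 * Real.Gamma ((k + 1) / 2) := by
  have h := integral_rpow_mul_exp_neg_rpow (p := 2) (q := k) (by norm_num)
    (lt_of_lt_of_le (by norm_num) (Nat.cast_nonneg k))
  simpa only [Real.rpow_natCast, Real.rpow_two] using h

theorem integral_even_pow_mul_exp_neg_sq (k : ℕ) :
    ∫ x : ℝ, x ^ (2 * k) * Real.exp (-x ^ 2) = Real.Gamma (k + 1 / 2) := by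
  have h := integral_comp_abs (f := fun x : ℝ ↦ x ^ (2 * k) * Real.exp (-x ^ 2))
  simp only [pow_mul, sq_abs] at h
  simp only [pow_mul, h]
  simp only [← pow_mul, integral_Ioi_pow_mul_exp_neg_sq]
  push_cast
  rw [← mul_assoc, mul_one_div_cancel two_ne_zero, one_mul]
  congr 1
  ring

theorem integrable_pow_mul_exp_neg_sq (k : ℕ) :
    Integrable fun x : ℝ ↦ x ^ k * Real.exp (-x ^ 2) := by
  have h := integrable_rpow_mul_exp_neg_mul_sq (b := 1) one_pos (s := k)
    (lt_of_lt_of_le (by norm_num) (Nat.cast_nonneg k))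
  simpa only [Real.rpow_natCast, neg_mul, one_mul] using h

theorem monomial_mul_exp_eq_prod (p : Fin 3 → ℕ) (x : Fin 3 → ℝ) :
    (x 0 ^ p 0 * x 1 ^ p 1 * x 2 ^ p 2) * Real.exp (-∑ i, x i ^ 2) =
      ∏ i, x i ^ p i * Real.exp (-x i ^ 2) := by
  rw [Finset.prod_mul_distrib, ← Real.exp_sum, Finset.sum_neg_distrib, Fin.prod_univ_three]

theorem integrable_monomial_mul_exp (p : Fin 3 → ℕ) :
    Integrable fun x : Fin 3 → ℝ ↦
      (x 0 ^ p 0 * x 1 ^ p 1 * x 2 ^ p 2) * Real.exp (-∑ i, x i ^ 2) := by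
  simp only [monomial_mul_exp_eq_prod]
  exact Integrable.fintype_prod (f := fun i (t : ℝ) ↦ t ^ p i * Real.exp (-t ^ 2))
    fun i ↦ integrable_pow_mul_exp_neg_sq (p i)

theorem integral_even_monomial_mul_exp (p : Fin 3 → ℕ) :
    ∫ x : Fin 3 → ℝ,
        (x 0 ^ (2 * p 0) * x 1 ^ (2 * p 1) * x 2 ^ (2 * p 2)) * Real.exp (-∑ i, x i ^ 2) =
      ∏ i, Real.Gamma (p i + 1 / 2) := by
  simp only [monomial_mul_exp_eq_prod (fun i ↦ 2 * p i)]
  rw [integral_fintype_prod_volume_eq_prod (fun i (t : ℝ) ↦ t ^ (2 * p i) * Real.exp (-t ^ 2))]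
  simp only [integral_even_pow_mul_exp_neg_sq]

theorem integral_sq_add_sq_mul_sq_mul_exp :
    ∫ x : Fin 3 → ℝ, (x 0 ^ 2 + x 1 ^ 2) * x 0 ^ 2 * Real.exp (-∑ i, x i ^ 2) =
      √Real.pi ^ 3 := by
  have h₁ := integrable_monomial_mul_exp ![4, 0, 0]
  have h₂ := integrable_monomial_mul_exp ![2, 2, 0]
  have e₁ := integral_even_monomial_mul_exp ![2, 0, 0]
  have e₂ := integral_even_monomial_mul_exp ![1, 1, 0]
  have g₀ := Real.Gamma_nat_add_half 0
  have g₁ := Real.Gamma_nat_add_half 1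
  have g₂ := Real.Gamma_nat_add_half 2
  simp only [Fin.prod_univ_three, Matrix.cons_val_zero, Matrix.cons_val_one, Matrix.cons_val,
    g₀, g₁, g₂, mul_zero, mul_one, pow_zero] at h₁ h₂ e₁ e₂
  calc
    _ = ∫ x : Fin 3 → ℝ, (x 0 ^ 4 * Real.exp (-∑ i, x i ^ 2) +
          x 0 ^ 2 * x 1 ^ 2 * Real.exp (-∑ i, x i ^ 2)) := by
      congr 1 with x
      ring
    _ = √Real.pi ^ 3 := by
      rw [integral_add h₁ h₂, e₂]
      norm_num at e₁ ⊢
      rw [e₁]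
      ring

theorem exists_orthonormalBasis_zero_two {E : Type*} [NormedAddCommGroup E] [InnerProductSpace ℝ E]
    [FiniteDimensional ℝ E] (hd : Module.finrank ℝ E = 3) {u v : E} (hu : ‖u‖ = 1) (hv : ‖v‖ = 1)
    (huv : ⟪u, v⟫ = 0) :
    ∃ e : OrthonormalBasis (Fin 3) ℝ E, e 0 = u ∧ e 2 = v := by
  have ho : Orthonormal ℝ (({0, 2} : Set (Fin 3)).domRestrict ![u, 0, v]) := by
    refine ⟨?_, ?_⟩
    · rintro ⟨i, rfl | rfl⟩ <;> simpa
    · rintro ⟨i, rfl | rfl⟩ ⟨j, rfl | rfl⟩ hij <;>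
        simp_all [real_inner_comm]
  obtain ⟨e, he⟩ := ho.exists_orthonormalBasis_extension_of_card_eq (by simpa using hd)
  exact ⟨e, by simpa using he 0 (by simp), by simpa using he 2 (by simp)⟩

section Inner

variable {E : Type*} [NormedAddCommGroup E] [InnerProductSpace ℝ E] [MeasurableSpace E]
  [BorelSpace E] [FiniteDimensional ℝ E]

theorem integral_gaussian_mul_quartic (e : OrthonormalBasis (Fin 3) ℝ E) :
    ∫ x : E, (‖x‖ ^ 2 - ⟪e 2, x⟫ ^ 2) * ⟪e 0, x⟫ ^ 2 * Real.exp (-‖x‖ ^ 2) = √Real.pi ^ 3 := by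
  have hm := (EuclideanSpace.volume_preserving_symm_measurableEquiv_toLp (Fin 3)).comp
    e.measurePreserving_measurableEquiv
  rw [← integral_sq_add_sq_mul_sq_mul_exp, ← hm.integral_comp
    ((MeasurableEquiv.measurableEmbedding _).comp (MeasurableEquiv.measurableEmbedding _))]
  congr 1 with x
  have hx : ‖x‖ ^ 2 = ⟪e 0, x⟫ ^ 2 + ⟪e 1, x⟫ ^ 2 + ⟪e 2, x⟫ ^ 2 := by
    rw [← e.sum_sq_inner_right x, Fin.sum_univ_three]
  have hc (i : Fin 3) : ((MeasurableEquiv.toLp 2 (Fin 3 → ℝ)).symm ∘ e.measurableEquiv) x i =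
      ⟪e i, x⟫ := e.repr_apply_apply x i
  simp only [hc, Fin.sum_univ_three, hx]
  ring_nf

theorem integral_sphere_quartic (hd : Module.finrank ℝ E = 3)
    (e : OrthonormalBasis (Fin 3) ℝ E) :
    ∫ ω : Metric.sphere (0 : E) 1, (1 - ⟪e 2, (ω : E)⟫ ^ 2) * ⟪e 0, (ω : E)⟫ ^ 2
      ∂(volume : Measure E).toSphere = 16 * Real.pi / 15 := by
  have : Nontrivial E := Module.nontrivial_of_finrank_pos (R := ℝ) (by omega)
  have h := integral_radial_mul_angular (volume : Measure E)
    (fun r ↦ r ^ 4 * Real.exp (-r ^ 2)) (fun x ↦ (1 - ⟪e 2, x⟫ ^ 2) * ⟪e 0, x⟫ ^ 2)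
  have hL : ∫ x : E, ‖x‖ ^ 4 * Real.exp (-‖x‖ ^ 2) *
      ((1 - ⟪e 2, ‖x‖⁻¹ • x⟫ ^ 2) * ⟪e 0, ‖x‖⁻¹ • x⟫ ^ 2) = √Real.pi ^ 3 := by
    rw [← integral_gaussian_mul_quartic e]
    congr 1 with x
    rcases eq_or_ne x 0 with rfl | hx
    · simp
    · have := norm_ne_zero_iff.2 hx
      simp only [inner_smul_right]
      field_simp
  have hR : ∫ r in Set.Ioi (0 : ℝ), r ^ (3 - 1) * (r ^ 4 * Real.exp (-r ^ 2)) =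
      15 * √Real.pi / 16 := by
    simp only [← mul_assoc, ← pow_add]
    rw [integral_Ioi_pow_mul_exp_neg_sq]
    have g := Real.Gamma_nat_add_half 3
    norm_num [Nat.doubleFactorial] at g ⊢
    rw [g]
    ring
  rw [hL, hd, hR] at h
  have hpi := Real.sq_sqrt Real.pi_pos.le
  have hpos := Real.sqrt_pos.2 Real.pi_pos
  apply mul_right_cancel₀ hpos.ne'
  linear_combination (-16 / 15) * h + (16 / 15) * √Real.pi * hpi

theorem integral_annulus_sin_sq_mul_inner_sq (hd : Module.finrank ℝ E = 3) {u v : E}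
    (hu : ‖u‖ = 1) (hv : v ≠ 0) (huv : ⟪u, v⟫ = 0) (γ : ℝ) {R : ℝ} (hR : 1 ≤ R) :
    ∫ x in {x : E | 1 ≤ ‖x‖ ∧ ‖x‖ ≤ R}, ‖x‖ ^ (-(2 : ℝ) * γ - 2) *
        (1 - ⟪x, v⟫ ^ 2 / (‖x‖ ^ 2 * ‖v‖ ^ 2)) * (⟪u, x⟫ * ⟪u, x⟫) =
      (16 * Real.pi / 15) * ∫ r in (1 : ℝ)..R, r ^ ((2 : ℝ) - 2 * γ) := by
  have : Nontrivial E := Module.nontrivial_of_finrank_pos (R := ℝ) (by omega)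
  have hv' := norm_ne_zero_iff.2 hv
  obtain ⟨e, h0, h2⟩ := exists_orthonormalBasis_zero_two hd hu
    (norm_smul_inv_norm (𝕜 := ℝ) hv) (by simp [inner_smul_right, huv])
  have hs : MeasurableSet {x : E | 1 ≤ ‖x‖ ∧ ‖x‖ ≤ R} :=
    (measurableSet_le measurable_const measurable_norm).inter
      (measurableSet_le measurable_norm measurable_const)
  have h := integral_radial_mul_angular (volume : Measure E)
    ((Set.Icc 1 R).indicator fun r ↦ r ^ (-(2 : ℝ) * γ))
    (fun x ↦ (1 - ⟪e 2, x⟫ ^ 2) * ⟪e 0, x⟫ ^ 2)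
  rw [integral_sphere_quartic hd, hd] at h
  rw [← integral_indicator hs]
  convert! h using 1
  · congr 1 with x
    by_cases hx : 1 ≤ ‖x‖ ∧ ‖x‖ ≤ R
    · have hpos : 0 < ‖x‖ := one_pos.trans_le hx.1
      rw [Set.indicator_of_mem (show x ∈ {x : E | 1 ≤ ‖x‖ ∧ ‖x‖ ≤ R} from hx),
        Set.indicator_of_mem (show ‖x‖ ∈ Set.Icc 1 R from hx), h0, h2, Real.rpow_sub hpos,
        Real.rpow_two]
      simp only [inner_smul_right, inner_smul_left, real_inner_comm x v]
      simp
      field_simp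
    · rw [Set.indicator_of_notMem (show x ∉ {x : E | 1 ≤ ‖x‖ ∧ ‖x‖ ≤ R} from hx),
        Set.indicator_of_notMem (show ‖x‖ ∉ Set.Icc 1 R from hx), zero_mul]
  · congr 1
    rw [intervalIntegral.integral_of_le hR, ← integral_Icc_eq_integral_Ioc,
      ← integral_indicator measurableSet_Icc, ← integral_indicator measurableSet_Ioi]
    congr 1 with r
    by_cases hr : r ∈ Set.Icc 1 R
    · have hpos : 0 < r := one_pos.trans_le hr.1
      rw [Set.indicator_of_mem hr, Set.indicator_of_mem (show r ∈ Set.Ioi (0 : ℝ) from hpos),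
        Set.indicator_of_mem hr, ← Real.rpow_natCast, ← Real.rpow_add hpos]
      congr 1
      push_cast
      ring
    · rw [Set.indicator_of_notMem hr, Set.indicator_apply, Set.indicator_of_notMem hr, mul_zero,
        ite_self]

theorem integral_annulus_sin_sq_mul_inner_mul_inner_eq_zero {u w v : E}
    (huw : ⟪u, w⟫ = 0) (huv : ⟪u, v⟫ = 0) (γ R : ℝ) :
    ∫ x in {x : E | 1 ≤ ‖x‖ ∧ ‖x‖ ≤ R}, ‖x‖ ^ (-(2 : ℝ) * γ - 2) *
        (1 - ⟪x, v⟫ ^ 2 / (‖x‖ ^ 2 * ‖v‖ ^ 2)) * (⟪u, x⟫ * ⟪w, x⟫) = 0 := by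
  set T : E ≃ₗᵢ[ℝ] E := (ℝ ∙ u)ᗮ.reflection
  have hfix {y : E} (hy : ⟪u, y⟫ = 0) : T y = y :=
    Submodule.reflection_mem_subspace_eq_self
      (Submodule.mem_orthogonal_singleton_iff_inner_right.2 hy)
  have hTu : T u = -u := Submodule.reflection_orthogonalComplement_singleton_eq_neg u
  have hv (x : E) : ⟪T x, v⟫ = ⟪x, v⟫ := by
    conv_lhs => rw [← hfix huv, T.inner_map_map]
  have hw (x : E) : ⟪w, T x⟫ = ⟪w, x⟫ := by
    conv_lhs => rw [← hfix huw, T.inner_map_map]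
  have hu (x : E) : ⟪u, T x⟫ = -⟪u, x⟫ := by
    rw [← T.inner_map_map u x, hTu, inner_neg_left, neg_neg]
  have h := T.measurePreserving.setIntegral_preimage_emb T.toHomeomorph.measurableEmbedding
    (fun x ↦ ‖x‖ ^ (-(2 : ℝ) * γ - 2) *
      (1 - ⟪x, v⟫ ^ 2 / (‖x‖ ^ 2 * ‖v‖ ^ 2)) * (⟪u, x⟫ * ⟪w, x⟫))
    {x : E | 1 ≤ ‖x‖ ∧ ‖x‖ ≤ R}
  simp only [Set.preimage_ofPred_eq, T.norm_map, hv, hw, hu, neg_mul, mul_neg, integral_neg] at h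
  simp only [neg_mul]
  linarith

end Inner

theorem rnorm_eq_norm_toLp {d : ℕ} (x : Fin d → ℝ) : rnorm x = ‖WithLp.toLp 2 x‖ := by
  simp [rnorm, EuclideanSpace.norm_eq]

theorem sum_mul_eq_inner_toLp {d : ℕ} (x y : Fin d → ℝ) :
    ∑ i, x i * y i = ⟪WithLp.toLp 2 x, WithLp.toLp 2 y⟫ := by
  simp [PiLp.inner_apply, mul_comm]

/-- 3D integral identity: for `γ ∈ (0, 3/2)`, `l ≠ 0` and unit
vectors `a, b ⟂ l`,
`∫_{1 ≤ |x| ≤ N} |x|^{-2γ-2} sin²(∠_{x,l}) (a·x)(b·x) dx = (16π/15) ∫_1^N r^{2-2γ} dr`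
if `a = b`, and the integral vanishes if `a·b = 0`. -/
theorem stmt14 (γ : ℝ) (hγ : 0 < γ ∧ γ < 3 / 2) (l : Fin 3 → ℝ) (hl : l ≠ 0)
    (a b : Fin 3 → ℝ) (ha : ∑ i, a i ^ 2 = 1) (hb : ∑ i, b i ^ 2 = 1)
    (hal : ∑ i, a i * l i = 0) (hbl : ∑ i, b i * l i = 0)
    (N : ℕ) (hN : 1 ≤ N) :
    (a = b →
      (∫ x in {x : Fin 3 → ℝ | 1 ≤ rnorm x ∧ rnorm x ≤ N},
          rnorm x ^ (-(2 : ℝ) * γ - 2) *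
            (1 - (∑ i, x i * l i) ^ 2 / (rnorm x ^ 2 * rnorm l ^ 2)) *
            ((∑ i, a i * x i) * (∑ i, b i * x i))) =
        (16 * Real.pi / 15) * ∫ r in (1 : ℝ)..(N : ℝ), r ^ ((2 : ℝ) - 2 * γ)) ∧
    ((∑ i, a i * b i) = 0 →
      (∫ x in {x : Fin 3 → ℝ | 1 ≤ rnorm x ∧ rnorm x ≤ N},
          rnorm x ^ (-(2 : ℝ) * γ - 2) *
            (1 - (∑ i, x i * l i) ^ 2 / (rnorm x ^ 2 * rnorm l ^ 2)) *
            ((∑ i, a i * x i) * (∑ i, b i * x i))) = 0) := by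
  have key (F : EuclideanSpace ℝ (Fin 3) → ℝ) (s : Set (EuclideanSpace ℝ (Fin 3))) :
      ∫ x in WithLp.toLp 2 ⁻¹' s, F (WithLp.toLp 2 x) = ∫ x in s, F x :=
    (PiLp.volume_preserving_toLp (Fin 3)).setIntegral_preimage_emb
      (MeasurableEquiv.toLp 2 (Fin 3 → ℝ)).measurableEmbedding F s
  have hR : (1 : ℝ) ≤ N := by exact_mod_cast hN
  have ha' : ‖WithLp.toLp 2 a‖ = 1 := by rw [← rnorm_eq_norm_toLp, rnorm, ha, Real.sqrt_one]
  have hl' : WithLp.toLp 2 l ≠ 0 := by simpa using hl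
  simp only [rnorm_eq_norm_toLp, sum_mul_eq_inner_toLp] at hal ⊢
  refine ⟨?_, fun hab ↦ ?_⟩
  · rintro rfl
    rw [← integral_annulus_sin_sq_mul_inner_sq (by simp) ha' hl' hal γ hR, ← key]
    rfl
  · rw [← integral_annulus_sin_sq_mul_inner_mul_inner_eq_zero hab hal γ N, ← key]
    rfl
end
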